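/- Let ε = e^{2πi/5}, u_5(x,y) = x^8 + x^7y + 7x^6y^2 − 7x^5y^3 + 7x^3y^5 + 7x^2y^6 − xy^7 + y^8, and for k = 1,…,5 set u_k(x,y) = u_5(ε^{3k}x, ε^{2k}y). Let F(x,y) = x·y·(x^10 − 11x^5y^5 − y^10) and H(x,y) = x^20 + 228x^15y^5 + 494x^10y^10 − 228x^5y^15 + y^20. Then, in the polynomial ring ℂ[x,y][v], the product ∏_{k=1}^{5} (H·v − F·u_k) equals H^5·v^5 − 40·F^5·H^2·v^2 − 5·F^5·H^2·v − F^5·H^2. -/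

import Mathlib

open MvPolynomial

noncomputable def ε : ℂ := Complex.exp (2 * Real.pi * Complex.I / 5)

noncomputable def u5 : MvPolynomial (Fin 2) ℂ :=
  (X 0) ^ 8 + (X 0) ^ 7 * X 1 + 7 * (X 0) ^ 6 * (X 1) ^ 2 - 7 * (X 0) ^ 5 * (X 1) ^ 3
    + 7 * (X 0) ^ 3 * (X 1) ^ 5 + 7 * (X 0) ^ 2 * (X 1) ^ 6 - X 0 * (X 1) ^ 7 + (X 1) ^ 8

/-- `u k` is `u5(ε^(3k) x, ε^(2k) y)`. -/
noncomputable def u (k : ℕ) : MvPolynomial (Fin 2) ℂ :=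
  aeval ![C (ε ^ (3 * k)) * X 0, C (ε ^ (2 * k)) * X 1] u5

noncomputable def F : MvPolynomial (Fin 2) ℂ :=
  X 0 * X 1 * ((X 0) ^ 10 - 11 * (X 0) ^ 5 * (X 1) ^ 5 - (X 1) ^ 10)

noncomputable def H : MvPolynomial (Fin 2) ℂ :=
  (X 0) ^ 20 + 228 * (X 0) ^ 15 * (X 1) ^ 5 + 494 * (X 0) ^ 10 * (X 1) ^ 10
    - 228 * (X 0) ^ 5 * (X 1) ^ 15 + (X 1) ^ 20

section CommRing

variable {R : Type*} [CommRing R]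

/-- The product over the fifth roots of unity of `T - (ζa + ζ²b + ζ³c + ζ⁴d)`. -/
lemma prod_sub_fifth_roots_combination {z : R} (hz : 1 + z + z ^ 2 + z ^ 3 + z ^ 4 = 0)
    (T a b c d : R) :
    ∏ k ∈ Finset.Icc 1 5,
        (T - (z ^ k * a + z ^ (2 * k) * b + z ^ (3 * k) * c + z ^ (4 * k) * d)) =
      T ^ 5 - 5 * (a * d + b * c) * T ^ 3
        - 5 * (a ^ 2 * c + a * b ^ 2 + b * d ^ 2 + c ^ 2 * d) * T ^ 2
        + 5 * (a ^ 2 * d ^ 2 + b ^ 2 * c ^ 2 - a * b * c * d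
          - (a ^ 3 * b + b ^ 3 * d + c ^ 3 * a + d ^ 3 * c)) * T
        - (a ^ 5 + b ^ 5 + c ^ 5 + d ^ 5
          - 5 * (a ^ 3 * c * d + a * b ^ 3 * c + b * c ^ 3 * d + a * b * d ^ 3)
          + 5 * (a ^ 2 * b ^ 2 * d + a ^ 2 * b * c ^ 2 + a * c ^ 2 * d ^ 2
            + b ^ 2 * c * d ^ 2)) := by
  have h5 : z ^ 5 = 1 := by linear_combination (z - 1) * hz
  have hpow (n : ℕ) : z ^ n = z ^ (n % 5) := pow_eq_pow_mod n h5
  obtain ⟨w, hw⟩ : ∃ w, w = z + z ^ 4 := ⟨_, rfl⟩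
  have hw' : z ^ 2 + z ^ 3 = -1 - w := by linear_combination hz + hw
  have hww : w ^ 2 = 1 - w := by
    subst hw
    linear_combination hz + (z ^ 3 + 2) * h5
  have pair (p q r s : R) :
      (T - (z * p + z ^ 2 * q + z ^ 3 * r + z ^ 4 * s)) *
          (T - (z ^ 4 * p + z ^ 3 * q + z ^ 2 * r + z * s)) =
        T ^ 2 + p ^ 2 + q ^ 2 + r ^ 2 + s ^ 2
          + w * (p * q + q * r + r * s - T * (p + s))
          + (-1 - w) * (p * r + q * s + p * s - T * (q + r)) := by
    rw [← hw', hw]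
    linear_combination (p ^ 2 + q ^ 2 + r ^ 2 + s ^ 2 + z * (p * q + q * r + r * s)
      + z ^ 3 * (p * s) + z ^ 2 * (p * r + q * s)) * h5
  have pair₁ := pair a b c d
  have pair₂ := pair c a d b
  have h6 : z ^ 6 = z := hpow 6 |>.trans (pow_one z)
  have h8 : z ^ 8 = z ^ 3 := hpow 8
  have h9 : z ^ 9 = z ^ 4 := hpow 9
  have h10 : z ^ 10 = 1 := hpow 10 |>.trans (pow_zero z)
  have h12 : z ^ 12 = z ^ 2 := hpow 12
  have h15 : z ^ 15 = 1 := hpow 15 |>.trans (pow_zero z)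
  have h16 : z ^ 16 = z := hpow 16 |>.trans (pow_one z)
  have h20 : z ^ 20 = 1 := hpow 20 |>.trans (pow_zero z)
  simp only [Finset.prod_Icc_succ_top, Nat.reduceAdd, Nat.reduceMul, Nat.reduceLeDiff,
    Finset.Icc_self, Finset.prod_singleton, pow_one, one_mul, h5, h6, h8, h9, h10, h12, h15, h16,
    h20]
  set U₁ := a * b + b * c + c * d - T * (a + d) with hU₁
  set V₁ := a * c + b * d + a * d - T * (b + c) with hV₁
  set U₂ := c * a + a * d + d * b - T * (c + b) with hU₂
  set V₂ := c * d + a * b + c * b - T * (a + d) with hV₂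
  set N := T ^ 2 + a ^ 2 + b ^ 2 + c ^ 2 + d ^ 2 with hN
  calc
    _ = (T - (a + b + c + d)) *
        ((N + w * U₁ + (-1 - w) * V₁) * (N + w * U₂ + (-1 - w) * V₂)) := by
      linear_combination (T - (a + b + c + d)) *
        ((T - (z ^ 2 * a + z ^ 4 * b + z * c + z ^ 3 * d)) *
          (T - (z ^ 3 * a + z * b + z ^ 4 * c + z ^ 2 * d)) * pair₁ +
        (N + w * U₁ + (-1 - w) * V₁) * pair₂)
    _ = _ := by
      simp only [hU₁, hV₁, hU₂, hV₂, hN]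
      linear_combination (T - (a + b + c + d)) *
        (a * b + b * c + c * d - T * (a + d) - (a * c + b * d + a * d - T * (b + c))) *
        (c * a + a * d + d * b - T * (c + b) - (c * d + a * b + c * b - T * (a + d))) * hww

/-- The resolvent identity over any commutative ring with a root of the fifth cyclotomic
polynomial. -/
lemma prod_octavic_twists {z : R} (hz : 1 + z + z ^ 2 + z ^ 3 + z ^ 4 = 0) (x y v f h : R)
    (hf : f = x * y * (x ^ 10 - 11 * x ^ 5 * y ^ 5 - y ^ 10))
    (hh : h = x ^ 20 + 228 * x ^ 15 * y ^ 5 + 494 * x ^ 10 * y ^ 10 - 228 * x ^ 5 * y ^ 15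
      + y ^ 20) :
    ∏ k ∈ Finset.Icc 1 5,
        (h * v - f * (z ^ k * (y ^ 8 - 7 * x ^ 5 * y ^ 3)
          + z ^ (2 * k) * (7 * x ^ 6 * y ^ 2 - x * y ^ 7)
          + z ^ (3 * k) * (x ^ 7 * y + 7 * x ^ 2 * y ^ 6)
          + z ^ (4 * k) * (x ^ 8 + 7 * x ^ 3 * y ^ 5))) =
      h ^ 5 * v ^ 5 - 40 * f ^ 5 * h ^ 2 * v ^ 2 - 5 * f ^ 5 * h ^ 2 * v - f ^ 5 * h ^ 2 := by
  obtain ⟨a, ha⟩ : ∃ a, a = y ^ 8 - 7 * x ^ 5 * y ^ 3 := ⟨_, rfl⟩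
  obtain ⟨b, hb⟩ : ∃ b, b = 7 * x ^ 6 * y ^ 2 - x * y ^ 7 := ⟨_, rfl⟩
  obtain ⟨c, hc⟩ : ∃ c, c = x ^ 7 * y + 7 * x ^ 2 * y ^ 6 := ⟨_, rfl⟩
  obtain ⟨d, hd⟩ : ∃ d, d = x ^ 8 + 7 * x ^ 3 * y ^ 5 := ⟨_, rfl⟩
  have e₂ : a * d + b * c = 0 := by rw [ha, hb, hc, hd]; ring
  have e₃ : a ^ 2 * c + a * b ^ 2 + b * d ^ 2 + c ^ 2 * d = 8 * f ^ 2 := by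
    rw [ha, hb, hc, hd, hf]; ring
  have e₄ : a ^ 2 * d ^ 2 + b ^ 2 * c ^ 2 - a * b * c * d
      - (a ^ 3 * b + b ^ 3 * d + c ^ 3 * a + d ^ 3 * c) = -(f * h) := by
    rw [ha, hb, hc, hd, hf, hh]; ring
  have e₅ : a ^ 5 + b ^ 5 + c ^ 5 + d ^ 5
      - 5 * (a ^ 3 * c * d + a * b ^ 3 * c + b * c ^ 3 * d + a * b * d ^ 3)
      + 5 * (a ^ 2 * b ^ 2 * d + a ^ 2 * b * c ^ 2 + a * c ^ 2 * d ^ 2 + b ^ 2 * c * d ^ 2)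
      = h ^ 2 := by
    rw [ha, hb, hc, hd, hh]; ring
  rw [← ha, ← hb, ← hc, ← hd]
  have key := prod_sub_fifth_roots_combination hz (h * v) (f * a) (f * b) (f * c) (f * d)
  have hfactor (k : ℕ) : f * (z ^ k * a + z ^ (2 * k) * b + z ^ (3 * k) * c + z ^ (4 * k) * d) =
      z ^ k * (f * a) + z ^ (2 * k) * (f * b) + z ^ (3 * k) * (f * c) + z ^ (4 * k) * (f * d) := by
    ring
  simp only [hfactor, key]
  linear_combination -5 * f ^ 2 * (h * v) ^ 3 * e₂ - 5 * f ^ 3 * (h * v) ^ 2 * e₃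
    + 5 * f ^ 4 * (h * v) * e₄ - f ^ 5 * e₅

end CommRing

lemma ε_geom_sum : 1 + ε + ε ^ 2 + ε ^ 3 + ε ^ 4 = 0 := by
  have h := (Complex.isPrimitiveRoot_exp 5 (by norm_num)).geom_sum_eq_zero (by norm_num)
  simpa [Finset.sum_range_succ, ε] using h

lemma ε_pow_five : ε ^ 5 = 1 := by
  linear_combination (ε - 1) * ε_geom_sum

lemma u_eq (k : ℕ) :
    u k = C ε ^ k * (X 1 ^ 8 - 7 * X 0 ^ 5 * X 1 ^ 3)
      + C ε ^ (2 * k) * (7 * X 0 ^ 6 * X 1 ^ 2 - X 0 * X 1 ^ 7)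
      + C ε ^ (3 * k) * (X 0 ^ 7 * X 1 + 7 * X 0 ^ 2 * X 1 ^ 6)
      + C ε ^ (4 * k) * (X 0 ^ 8 + 7 * X 0 ^ 3 * X 1 ^ 5) := by
  have h : (C ε ^ k : MvPolynomial (Fin 2) ℂ) ^ 5 = 1 := by
    rw [← pow_mul, mul_comm, pow_mul, ← C_pow, ε_pow_five, C_1, one_pow]
  simp only [u, u5, map_add, map_sub, map_mul, map_pow, map_ofNat, aeval_X,
    Matrix.cons_val_zero, Matrix.cons_val_one, mul_comm _ k, pow_mul]
  set t : MvPolynomial (Fin 2) ℂ := C ε ^ k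
  have ht (m n : ℕ) (hmn : m % 5 = n % 5) : t ^ m = t ^ n := by
    rw [pow_eq_pow_mod m h, pow_eq_pow_mod n h, hmn]
  have h24 : t ^ 24 = t ^ 4 := ht _ _ rfl
  have h23 : t ^ 23 = t ^ 3 := ht _ _ rfl
  have h22 : t ^ 22 = t ^ 2 := ht _ _ rfl
  have h21 : t ^ 21 = t := (ht 21 1 rfl).trans (pow_one t)
  have h19 : t ^ 19 = t ^ 4 := ht _ _ rfl
  have h18 : t ^ 18 = t ^ 3 := ht _ _ rfl
  have h17 : t ^ 17 = t ^ 2 := ht _ _ rfl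
  have h16 : t ^ 16 = t := (ht 16 1 rfl).trans (pow_one t)
  ring_nf
  simp only [h24, h23, h22, h21, h19, h18, h17, h16]
  ring

open Polynomial in
theorem resolvent_identity :
    ∏ k ∈ Finset.Icc 1 5,
        (Polynomial.C H * Polynomial.X - Polynomial.C (F * u k)
          : Polynomial (MvPolynomial (Fin 2) ℂ)) =
      Polynomial.C (H ^ 5) * Polynomial.X ^ 5
        - Polynomial.C (40 * F ^ 5 * H ^ 2) * Polynomial.X ^ 2
        - Polynomial.C (5 * F ^ 5 * H ^ 2) * Polynomial.X
        - Polynomial.C (F ^ 5 * H ^ 2) := by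
  have hz : 1 + Polynomial.C (MvPolynomial.C ε) + Polynomial.C (MvPolynomial.C ε) ^ 2
      + Polynomial.C (MvPolynomial.C ε) ^ 3 + Polynomial.C (MvPolynomial.C ε) ^ 4 = (0 : Polynomial (MvPolynomial (Fin 2) ℂ)) := by
    simpa only [map_add, map_pow, map_one, map_zero] using
      congrArg (fun t => Polynomial.C (MvPolynomial.C t : MvPolynomial (Fin 2) ℂ)) ε_geom_sum
  have key := prod_octavic_twists hz (Polynomial.C (MvPolynomial.X 0))
    (Polynomial.C (MvPolynomial.X 1)) Polynomial.X (Polynomial.C F) (Polynomial.C H)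
    (by simp only [F, map_sub, map_mul, map_pow, map_ofNat])
    (by simp only [H, map_add, map_sub, map_mul, map_pow, map_ofNat])
  simpa only [u_eq, map_add, map_sub, map_mul, map_pow, map_ofNat] using key
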